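/- For every nonnegative finite Borel measure m on ℝ³, every η > 0, and every smooth compactly supported φ : ℝ³ → ℂ², one has ∫_{ℝ³} ‖(σ·∇φ)(x)‖²/(η + V_m(x)) dx ≥ ( 2π ∫_{ℝ³} ‖ξ‖·‖(𝓕φ)(ξ)‖² dξ − η ∫_{ℝ³} ‖φ(x)‖² dx ) / ( 2·max(1, 8·m(ℝ³)) ), where the left-hand integrand is interpreted as 0 at points where V_m(x) = +∞. -/

import Mathlib

open MeasureTheory Real FourierTransform

/-- The Coulomb potential generated by a measure `m` on `ℝ³` (real-valued:
`0` where the defining extended-real integral is infinite). -/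
noncomputable def coulomb (m : Measure (EuclideanSpace ℝ (Fin 3)))
    (x : EuclideanSpace ℝ (Fin 3)) : ℝ :=
  (∫⁻ y, ENNReal.ofReal ‖x - y‖⁻¹ ∂m).toReal

/-- The Pauli matrices. -/
noncomputable def pauli : Fin 3 → Matrix (Fin 2) (Fin 2) ℂ :=
  ![!![0, 1; 1, 0], !![0, -Complex.I; Complex.I, 0], !![1, 0; 0, -1]]

/-- `(σ·∇φ)(x) = ∑ⱼ σⱼ (∂ⱼφ)(x)` for `φ : ℝ³ → ℂ²`. -/
noncomputable def pauliDeriv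
    (φ : EuclideanSpace ℝ (Fin 3) → EuclideanSpace ℂ (Fin 2))
    (x : EuclideanSpace ℝ (Fin 3)) : EuclideanSpace ℂ (Fin 2) :=
  ∑ j : Fin 3, (WithLp.equiv 2 (Fin 2 → ℂ)).symm
    ((pauli j).mulVec (WithLp.equiv 2 (Fin 2 → ℂ)
      (fderiv ℝ φ x (EuclideanSpace.single j 1))))


local notation "ℝ³" => EuclideanSpace ℝ (Fin 3)

section GaussianKernel

open scoped RealInnerProductSpace

lemma integrable_gaussian_sub {b : ℝ} (hb : 0 < b) (y : ℝ³) :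
    Integrable (fun x : ℝ³ ↦ rexp (-(π * b) * ‖x - y‖ ^ 2)) := by
  have h := GaussianFourier.integrable_cexp_neg_mul_sq_norm_add (V := ℝ³) (b := ((π * b : ℝ) : ℂ))
    (by simpa using by positivity) 0 0
  have h' : Integrable (fun x : ℝ³ ↦ rexp (-(π * b) * ‖x‖ ^ 2)) := by
    refine h.norm.congr (ae_of_all _ fun x ↦ ?_)
    simp [Complex.norm_exp, ← Complex.ofReal_pow]
  exact h'.comp_sub_right y

lemma norm_integral_gaussian_mul_character {b : ℝ} (hb : 0 < b) (y ζ : ℝ³) :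
    ‖∫ x : ℝ³, Real.fourierChar ⟪x, ζ⟫ • (rexp (-(π * b) * ‖x - y‖ ^ 2) : ℂ)‖ =
      b ^ (-(3 / 2) : ℝ) * rexp (-(π / b) * ‖ζ‖ ^ 2) := by
  have hshift : ∫ x : ℝ³, Real.fourierChar ⟪x, ζ⟫ • (rexp (-(π * b) * ‖x - y‖ ^ 2) : ℂ) =
      Real.fourierChar ⟪y, ζ⟫ •
        ∫ x : ℝ³, Complex.exp (-((π * b : ℝ) : ℂ) * ‖x‖ ^ 2 + (2 * π * Complex.I) * ⟪ζ, x⟫) := by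
    rw [Circle.smul_def, smul_eq_mul, ← integral_const_mul, ← integral_sub_right_eq_self (fun x : ℝ³ ↦
      _ * Complex.exp (-((π * b : ℝ) : ℂ) * ‖x‖ ^ 2 + (2 * π * Complex.I) * ⟪ζ, x⟫)) y]
    refine integral_congr_ae (ae_of_all _ fun x ↦ ?_)
    have : ⟪x, ζ⟫ = ⟪y, ζ⟫ + ⟪ζ, x - y⟫ := by
      rw [inner_sub_right, real_inner_comm x ζ, real_inner_comm y ζ]; ring
    simp only [this, Circle.smul_def, smul_eq_mul, Real.fourierChar_apply]
    rw [← Complex.exp_add, Complex.ofReal_exp, ← Complex.exp_add]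
    congr 1
    push_cast
    ring
  rw [hshift, GaussianFourier.integral_cexp_neg_mul_sq_norm_add (by simpa using by positivity),
    Circle.norm_smul, norm_mul]
  congr 1
  · rw [finrank_euclideanSpace_fin]
    have : (π / ((π * b : ℝ) : ℂ)) = ((b⁻¹ : ℝ) : ℂ) := by
      push_cast
      field_simp
    rw [this, Complex.norm_cpow_eq_rpow_re_of_pos (by positivity), Real.inv_rpow hb.le,
      Real.rpow_neg hb.le]
    norm_num
  · rw [Complex.norm_exp]
    congr 1
    have : ((2 * π * Complex.I) ^ 2 * ‖ζ‖ ^ 2 / (4 * ((π * b : ℝ) : ℂ)) : ℂ) =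
        ((-(π / b) * ‖ζ‖ ^ 2 : ℝ) : ℂ) := by
      have := Complex.ofReal_ne_zero.2 hb.ne'
      have := Complex.ofReal_ne_zero.2 pi_ne_zero
      push_cast
      rw [mul_pow, Complex.I_sq]
      field_simp
      ring
    rw [this, Complex.ofReal_re]

end GaussianKernel

section GaussianForm

open scoped RealInnerProductSpace

variable {H : Type*} [NormedAddCommGroup H] [InnerProductSpace ℂ H]

lemma continuous_fourierInv {v : ℝ³ → H} (hv : Integrable v) : Continuous (𝓕⁻ v) := by
  rw [Real.fourierInv_eq_fourier_comp_neg]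
  exact VectorFourier.fourierIntegral_continuous Real.continuous_fourierChar
    (by exact continuous_inner) hv.comp_neg

lemma norm_fourierInv_le (v : ℝ³ → H) (x : ℝ³) : ‖𝓕⁻ v x‖ ≤ ∫ ξ, ‖v ξ‖ := by
  rw [Real.fourierInv_eq]
  refine (norm_integral_le_integral_norm _).trans_eq ?_
  simp

variable [CompleteSpace H]

lemma integral_inner_fourier_left {f v : ℝ³ → H} (hf : Integrable f) (hv : Integrable v) :
    ∫ ξ, inner ℂ (𝓕 f ξ) (v ξ) = ∫ x, inner ℂ (f x) (𝓕⁻ v x) := by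
  have := VectorFourier.integral_sesq_fourierIntegral_eq_neg_flip (μ := volume) (ν := volume)
    (innerSL ℂ) (L := innerₗ ℝ³) Real.continuous_fourierChar continuous_inner hf hv
  simp only [Real.fourierInv_eq, Real.fourier_eq]
  simpa [VectorFourier.fourierIntegral, real_inner_comm] using this

lemma integral_fourierInv_smul {f : ℝ³ → ℂ} {v : ℝ³ → H} (hf : Integrable f)
    (hv : Integrable v) : ∫ ξ, 𝓕⁻ f ξ • v ξ = ∫ x, f x • 𝓕⁻ v x := by
  have := VectorFourier.integral_fourierIntegral_smul_eq_flip (L := -innerₗ ℝ³)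
    (μ := volume) (ν := volume) Real.continuous_fourierChar
    (by exact (continuous_inner (𝕜 := ℝ) (E := ℝ³)).neg) hf hv
  simp only [Real.fourierInv_eq]
  simpa [VectorFourier.fourierIntegral, real_inner_comm] using this

lemma enorm_fourier_gaussian_smul_fourierInv_le {v : ℝ³ → H} (hv : Integrable v) {b : ℝ}
    (hb : 0 < b) (y ξ : ℝ³) :
    ‖𝓕 (fun x ↦ (rexp (-(π * b) * ‖x - y‖ ^ 2) : ℂ) • 𝓕⁻ v x) ξ‖ₑ ≤
      ∫⁻ ξ', ENNReal.ofReal (‖v ξ'‖ * (b ^ (-(3 / 2) : ℝ) * rexp (-(π / b) * ‖ξ' - ξ‖ ^ 2))) := by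
  set h : ℝ³ → ℂ := fun x ↦
    Real.fourierChar (-⟪x, ξ⟫) • (rexp (-(π * b) * ‖x - y‖ ^ 2) : ℂ) with hdef
  have hint : Integrable h := by
    refine (integrable_gaussian_sub hb y).mono' ?_ (ae_of_all _ fun x ↦ ?_)
    · refine Continuous.aestronglyMeasurable ?_
      have := Real.continuous_fourierChar
      fun_prop
    · rw [hdef, Circle.norm_smul, Complex.norm_real, Real.norm_of_nonneg (Real.exp_pos _).le]
  have e1 : 𝓕 (fun x ↦ (rexp (-(π * b) * ‖x - y‖ ^ 2) : ℂ) • 𝓕⁻ v x) ξ =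
      ∫ ξ', 𝓕⁻ h ξ' • v ξ' := by
    rw [integral_fourierInv_smul hint hv, Real.fourier_eq]
    refine integral_congr_ae (ae_of_all _ fun x ↦ ?_)
    simp only [hdef, smul_assoc]
  rw [e1]
  refine (enorm_integral_le_lintegral_enorm _).trans (lintegral_mono fun ξ' ↦ ?_)
  rw [← ofReal_norm, norm_smul, mul_comm,
    ← norm_integral_gaussian_mul_character hb y (ξ' - ξ)]
  refine ENNReal.ofReal_le_ofReal (le_of_eq ?_)
  congr 2
  rw [Real.fourierInv_eq]
  refine integral_congr_ae (ae_of_all _ fun x ↦ ?_)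
  simp only [hdef, smul_smul, ← AddChar.map_add_eq_mul, sub_eq_add_neg, inner_add_right,
    inner_neg_right]

lemma lintegral_fourierInv_mul_gaussian_le {v : ℝ³ → H} (hv : Integrable v) {b : ℝ}
    (hb : 0 < b) (y : ℝ³) :
    ∫⁻ x, ENNReal.ofReal (‖𝓕⁻ v x‖ ^ 2 * rexp (-(π * b) * ‖x - y‖ ^ 2)) ≤
      ∫⁻ ξ, ∫⁻ ξ', ENNReal.ofReal
        (‖v ξ‖ * ‖v ξ'‖ * (b ^ (-(3 / 2) : ℝ) * rexp (-(π / b) * ‖ξ' - ξ‖ ^ 2))) := by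
  have hχ := continuous_fourierInv hv
  have hG := integrable_gaussian_sub hb y
  have hint : Integrable fun x ↦ (rexp (-(π * b) * ‖x - y‖ ^ 2) : ℂ) • 𝓕⁻ v x := by
    refine (hG.mul_const (∫ ξ, ‖v ξ‖)).mono' ?_ (ae_of_all _ fun x ↦ ?_)
    · exact Continuous.aestronglyMeasurable (by fun_prop)
    · rw [norm_smul, Complex.norm_real, Real.norm_of_nonneg (Real.exp_pos _).le]
      gcongr
      exact norm_fourierInv_le v x
  have hint2 : Integrable fun x ↦ ‖𝓕⁻ v x‖ ^ 2 * rexp (-(π * b) * ‖x - y‖ ^ 2) := by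
    refine (hG.const_mul ((∫ ξ, ‖v ξ‖) ^ 2)).mono' ?_ (ae_of_all _ fun x ↦ ?_)
    · exact Continuous.aestronglyMeasurable (by fun_prop)
    · rw [Real.norm_of_nonneg (by positivity)]
      gcongr
      exact norm_fourierInv_le v x
  have e2 : ((∫ x, ‖𝓕⁻ v x‖ ^ 2 * rexp (-(π * b) * ‖x - y‖ ^ 2) : ℝ) : ℂ) =
      ∫ ξ, inner ℂ (𝓕 (fun x ↦ (rexp (-(π * b) * ‖x - y‖ ^ 2) : ℂ) • 𝓕⁻ v x) ξ) (v ξ) := by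
    rw [integral_inner_fourier_left hint hv, ← integral_complex_ofReal]
    refine integral_congr_ae (ae_of_all _ fun x ↦ ?_)
    simp only [inner_smul_left, inner_self_eq_norm_sq_to_K, Complex.conj_ofReal]
    push_cast
    exact mul_comm _ _
  rw [← ofReal_integral_eq_lintegral_ofReal hint2 (ae_of_all _ fun x ↦ by positivity),
    ← abs_of_nonneg (integral_nonneg fun x ↦ by positivity), ← Real.norm_eq_abs,
    ← Complex.norm_real, e2, ofReal_norm]
  refine (enorm_integral_le_lintegral_enorm _).trans (lintegral_mono fun ξ ↦ ?_)
  have : ‖inner ℂ (𝓕 (fun x ↦ (rexp (-(π * b) * ‖x - y‖ ^ 2) : ℂ) • 𝓕⁻ v x) ξ) (v ξ)‖ₑ ≤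
      ‖𝓕 (fun x ↦ (rexp (-(π * b) * ‖x - y‖ ^ 2) : ℂ) • 𝓕⁻ v x) ξ‖ₑ * ‖v ξ‖ₑ := by
    simp only [← ofReal_norm]
    rw [← ENNReal.ofReal_mul (norm_nonneg _)]
    exact ENNReal.ofReal_le_ofReal (norm_inner_le_norm _ _)
  refine this.trans ((mul_le_mul_left (enorm_fourier_gaussian_smul_fourierInv_le hv hb y ξ)
    _).trans ?_)
  rw [← lintegral_mul_const' _ _ enorm_ne_top]
  refine lintegral_mono fun ξ' ↦ le_of_eq ?_
  rw [← ofReal_norm, ← ENNReal.ofReal_mul (by positivity)]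
  ring_nf

end GaussianForm

section RadialIntegrals

open Set

lemma ofReal_inv_le_lintegral_gaussian (r : ℝ) :
    ENNReal.ofReal r⁻¹ ≤
      ∫⁻ s in Ioi (0 : ℝ), ENNReal.ofReal (2 * rexp (-(π * s ^ 2) * r ^ 2)) := by
  rcases le_or_gt r 0 with hr | hr
  · simp [ENNReal.ofReal_of_nonpos (inv_nonpos.2 hr)]
  have hb : 0 < π * r ^ 2 := by positivity
  have hint : IntegrableOn (fun s : ℝ ↦ 2 * rexp (-(π * r ^ 2) * s ^ 2)) (Ioi 0) :=
    ((integrable_exp_neg_mul_sq hb).const_mul 2).integrableOn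
  have hval : ∫ s in Ioi (0 : ℝ), 2 * rexp (-(π * r ^ 2) * s ^ 2) = r⁻¹ := by
    rw [integral_const_mul, integral_gaussian_Ioi, mul_div_cancel₀ _ two_ne_zero,
      show π / (π * r ^ 2) = (r⁻¹) ^ 2 by field_simp, Real.sqrt_sq (by positivity)]
  rw [← hval, ofReal_integral_eq_lintegral_ofReal hint (ae_of_all _ fun s ↦ by positivity)]
  refine le_of_eq (lintegral_congr fun s ↦ ?_)
  ring_nf

lemma integral_Ioi_mul_gaussian {a : ℝ} (ha : 0 < a) :
    IntegrableOn (fun t : ℝ ↦ 2 * (t * rexp (-a * t ^ 2))) (Ioi 0) ∧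
      ∫ t in Ioi (0 : ℝ), 2 * (t * rexp (-a * t ^ 2)) = a⁻¹ := by
  refine ⟨((integrable_mul_exp_neg_mul_sq ha).const_mul 2).integrableOn, ?_⟩
  have h := integral_rpow_mul_exp_neg_mul_rpow (p := 2) (q := 1) two_pos (by norm_num) ha
  rw [integral_const_mul]
  norm_num at h
  simp only [neg_mul]
  rw [h, Real.rpow_neg_one]
  ring

lemma lintegral_gaussian_inv_sq {r : ℝ} (hr : 0 < r) :
    ∫⁻ s in Ioi (0 : ℝ), ENNReal.ofReal
        (2 * ((s ^ 2) ^ (-(3 / 2) : ℝ) * rexp (-(π / s ^ 2) * r ^ 2))) =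
      ENNReal.ofReal (π * r ^ 2)⁻¹ := by
  have ha : 0 < π * r ^ 2 := by positivity
  obtain ⟨hint, hval⟩ := integral_Ioi_mul_gaussian ha
  have hcongr : ∀ s ∈ Ioi (0 : ℝ),
      (|(-1 : ℝ)| * s ^ ((-1 : ℝ) - 1)) •
          (2 * (s ^ (-1 : ℝ) * rexp (-(π * r ^ 2) * (s ^ (-1 : ℝ)) ^ 2))) =
        2 * ((s ^ 2) ^ (-(3 / 2) : ℝ) * rexp (-(π / s ^ 2) * r ^ 2)) := by
    intro s hs
    have hs : 0 < s := hs
    have h3 : (s ^ 2) ^ (-(3 / 2) : ℝ) = s ^ ((-1 : ℝ) - 1) * s ^ (-1 : ℝ) := by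
      rw [← Real.rpow_natCast, ← Real.rpow_mul hs.le, ← Real.rpow_add hs]
      norm_num
    rw [h3, smul_eq_mul, Real.rpow_neg_one, abs_neg, abs_one]
    have : -(π * r ^ 2) * s⁻¹ ^ 2 = -(π / s ^ 2) * r ^ 2 := by field_simp
    rw [this]
    ring
  have hint' := ((integrableOn_Ioi_comp_rpow_iff _ (p := -1) (by norm_num)).2 hint).congr_fun
    hcongr measurableSet_Ioi
  have hval' := (integral_comp_rpow_Ioi (fun t : ℝ ↦ 2 * (t * rexp (-(π * r ^ 2) * t ^ 2)))
    (p := -1) (by norm_num)).trans hval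
  rw [setIntegral_congr_fun measurableSet_Ioi hcongr] at hval'
  rw [← hval', ofReal_integral_eq_lintegral_ofReal hint' (ae_of_all _ fun s ↦ by positivity)]

lemma lintegral_inv_norm_sq_mul_inv {a : ℝ} (ha : 0 < a) :
    ∫⁻ z : ℝ³, ENNReal.ofReal (2 * (‖z‖ ^ 2 * (a ^ 2 + ‖z‖ ^ 2))⁻¹) =
      ENNReal.ofReal (4 * π ^ 2 / a) := by
  have hcongr : ∀ y ∈ Ioi (0 : ℝ),
      2 * (a ^ 2)⁻¹ * (1 + (a⁻¹ * y) ^ 2)⁻¹ =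
        y ^ (Module.finrank ℝ ℝ³ - 1) • (2 * (y ^ 2 * (a ^ 2 + y ^ 2))⁻¹) := by
    intro y hy
    have hy : 0 < y := hy
    rw [finrank_euclideanSpace_fin, smul_eq_mul]
    have : 0 < a ^ 2 + y ^ 2 := by positivity
    field_simp
  have h1 : IntegrableOn (fun y : ℝ ↦ 2 * (a ^ 2)⁻¹ * (1 + (a⁻¹ * y) ^ 2)⁻¹) (Ioi 0) :=
    ((integrable_inv_one_add_sq.comp_mul_left' (inv_ne_zero ha.ne')).const_mul _).integrableOn
  have hval : ∫ y in Ioi (0 : ℝ), 2 * (a ^ 2)⁻¹ * (1 + (a⁻¹ * y) ^ 2)⁻¹ = π / a := by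
    rw [integral_const_mul, integral_comp_mul_left_Ioi (fun y ↦ (1 + y ^ 2)⁻¹) 0 (inv_pos.2 ha),
      mul_zero, integral_Ioi_inv_one_add_sq, Real.arctan_zero, smul_eq_mul]
    field_simp
    ring
  have hint : Integrable fun z : ℝ³ ↦ 2 * (‖z‖ ^ 2 * (a ^ 2 + ‖z‖ ^ 2))⁻¹ :=
    (integrable_fun_norm_addHaar volume (f := fun y ↦ 2 * (y ^ 2 * (a ^ 2 + y ^ 2))⁻¹)).2
      (h1.congr_fun hcongr measurableSet_Ioi)
  rw [← ofReal_integral_eq_lintegral_ofReal hint (ae_of_all _ fun z ↦ by positivity),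
    integral_fun_norm_addHaar volume (fun y ↦ 2 * (y ^ 2 * (a ^ 2 + y ^ 2))⁻¹),
    ← setIntegral_congr_fun measurableSet_Ioi hcongr, hval, finrank_euclideanSpace_fin,
    Measure.real, EuclideanSpace.volume_ball_fin_three]
  congr 1
  norm_num [ENNReal.toReal_ofReal (show 0 ≤ π * 4 / 3 by positivity)]
  ring

end RadialIntegrals

section Schur

lemma two_mul_mul_le_weighted {u u' w w' : ℝ} (hw : 0 < w) (hw' : 0 < w') :
    2 * (u * u') ≤ u ^ 2 * (w / w') + u' ^ 2 * (w' / w) := by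
  have : u ^ 2 * (w / w') + u' ^ 2 * (w' / w) - 2 * (u * u') = (u * w - u' * w') ^ 2 / (w * w') := by
    field_simp
    ring
  have h2 : 0 ≤ (u * w - u' * w') ^ 2 / (w * w') := by positivity
  linarith

lemma lintegral_schur_test {α : Type*} [MeasurableSpace α] {μ : Measure α} [SFinite μ]
    {u w : α → ℝ} {K : α → α → ℝ} (hu : Measurable u) (hw : Measurable w)
    (hK : Measurable (Function.uncurry K)) (hK0 : ∀ x y, 0 ≤ K x y)
    (hsymm : ∀ x y, K x y = K y x) (hwpos : ∀ᵐ x ∂μ, 0 < w x) :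
    ∫⁻ x, ∫⁻ y, ENNReal.ofReal (u x * u y * K x y) ∂μ ∂μ ≤
      ∫⁻ x, ENNReal.ofReal (u x ^ 2) * ∫⁻ y, ENNReal.ofReal (w x / w y * K x y) ∂μ ∂μ := by
  have hF : Measurable (Function.uncurry fun x y ↦
      ENNReal.ofReal (u x ^ 2 * (w x / w y) * K x y)) := by
    unfold Function.uncurry at hK ⊢
    fun_prop
  have key : 2 * ∫⁻ x, ∫⁻ y, ENNReal.ofReal (u x * u y * K x y) ∂μ ∂μ ≤
      2 * ∫⁻ x, ∫⁻ y, ENNReal.ofReal (u x ^ 2 * (w x / w y) * K x y) ∂μ ∂μ := by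
    calc
      _ = ∫⁻ x, ∫⁻ y, ENNReal.ofReal (2 * (u x * u y) * K x y) ∂μ ∂μ := by
        rw [← lintegral_const_mul' _ _ ENNReal.ofNat_ne_top]
        refine lintegral_congr fun x ↦ ?_
        rw [← lintegral_const_mul' _ _ ENNReal.ofNat_ne_top]
        refine lintegral_congr fun y ↦ ?_
        rw [mul_assoc 2, ENNReal.ofReal_mul zero_le_two, ENNReal.ofReal_ofNat]
      _ ≤ ∫⁻ x, ∫⁻ y, (ENNReal.ofReal (u x ^ 2 * (w x / w y) * K x y) +
            ENNReal.ofReal (u y ^ 2 * (w y / w x) * K y x)) ∂μ ∂μ := by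
        refine lintegral_mono_ae (hwpos.mono fun x hx ↦ lintegral_mono_ae
          (hwpos.mono fun y hy ↦ ?_))
        have := hK0 x y
        rw [← hsymm x y, ← ENNReal.ofReal_add (by positivity) (by positivity), ← add_mul]
        exact ENNReal.ofReal_le_ofReal
          (mul_le_mul_of_nonneg_right (two_mul_mul_le_weighted hx hy) this)
      _ = ∫⁻ x, ∫⁻ y, ENNReal.ofReal (u x ^ 2 * (w x / w y) * K x y) ∂μ ∂μ +
            ∫⁻ x, ∫⁻ y, ENNReal.ofReal (u y ^ 2 * (w y / w x) * K y x) ∂μ ∂μ := by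
        have hF' : Measurable fun x ↦
            ∫⁻ y, ENNReal.ofReal (u x ^ 2 * (w x / w y) * K x y) ∂μ := hF.lintegral_prod_right'
        rw [← lintegral_add_left hF']
        exact lintegral_congr fun x ↦ lintegral_add_left (hF.comp measurable_prodMk_left) _
      _ = _ := by
        rw [two_mul, lintegral_lintegral_swap (f := fun x y ↦
          ENNReal.ofReal (u x ^ 2 * (w x / w y) * K x y)) hF.aemeasurable]
  refine ((ENNReal.mul_le_mul_iff_right two_ne_zero ENNReal.ofNat_ne_top).1 key).trans
    (le_of_eq (lintegral_congr fun x ↦ ?_))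
  rw [← lintegral_const_mul' _ _ ENNReal.ofReal_ne_top]
  refine lintegral_congr fun y ↦ ?_
  rw [← ENNReal.ofReal_mul (sq_nonneg _), mul_assoc]

lemma lintegral_coulomb_kernel_le (ξ : ℝ³) :
    ∫⁻ ξ', ENNReal.ofReal (‖ξ‖ ^ 2 / ‖ξ'‖ ^ 2 * (π * ‖ξ' - ξ‖ ^ 2)⁻¹) ≤
      ENNReal.ofReal (16 * π * ‖ξ‖) := by
  rcases eq_or_ne ξ 0 with rfl | hξ
  · simp
  have hR : 0 < ‖ξ‖ := norm_pos_iff.2 hξ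
  set a := ‖ξ‖ / 2 with ha
  have ha0 : 0 < a := by positivity
  set h : ℝ³ → ENNReal := fun z ↦ ENNReal.ofReal (2 * (‖z‖ ^ 2 * (a ^ 2 + ‖z‖ ^ 2))⁻¹) with hh
  have hmeas : Measurable h := by fun_prop
  have aux : ∀ p q : ℝ, 0 < p → p ≤ q → 2 * a ≤ p + q →
      (p ^ 2 * q ^ 2)⁻¹ ≤ 2 * (p ^ 2 * (a ^ 2 + p ^ 2))⁻¹ := by
    intro p q hp hpq hapq
    have hq : 0 < q := hp.trans_le hpq
    rw [← div_eq_mul_inv, inv_eq_one_div, div_le_div_iff₀ (by positivity) (by positivity)]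
    have h1 : a ^ 2 ≤ q ^ 2 := by gcongr; linarith
    have h2 : p ^ 2 ≤ q ^ 2 := by gcongr
    nlinarith [mul_le_mul_of_nonneg_left (add_le_add h1 h2) (sq_nonneg p)]
  have hne : ∀ᵐ ξ' : ℝ³, ξ' ≠ 0 ∧ ξ' - ξ ≠ 0 := by
    filter_upwards [Measure.ae_ne volume (0 : ℝ³), Measure.ae_ne volume ξ] with ξ' h0 h1
    exact ⟨h0, sub_ne_zero.2 h1⟩
  calc
    _ ≤ ∫⁻ ξ', ENNReal.ofReal (‖ξ‖ ^ 2 / π) * (h ξ' + h (ξ' - ξ)) := by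
      refine lintegral_mono_ae (hne.mono fun ξ' hξ' ↦ ?_)
      have hp : 0 < ‖ξ'‖ := norm_pos_iff.2 hξ'.1
      have hq : 0 < ‖ξ' - ξ‖ := norm_pos_iff.2 hξ'.2
      have htri : 2 * a ≤ ‖ξ'‖ + ‖ξ' - ξ‖ := by
        have := norm_sub_le ξ' (ξ' - ξ)
        rw [sub_sub_cancel] at this
        linarith
      rw [hh, ← ENNReal.ofReal_add (by positivity) (by positivity),
        ← ENNReal.ofReal_mul (by positivity)]
      refine ENNReal.ofReal_le_ofReal ?_
      have : ‖ξ‖ ^ 2 / ‖ξ'‖ ^ 2 * (π * ‖ξ' - ξ‖ ^ 2)⁻¹ =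
          ‖ξ‖ ^ 2 / π * (‖ξ'‖ ^ 2 * ‖ξ' - ξ‖ ^ 2)⁻¹ := by
        field_simp
      rw [this]
      gcongr
      rcases le_total ‖ξ'‖ ‖ξ' - ξ‖ with hle | hle
      · exact (aux _ _ hp hle htri).trans (le_add_of_nonneg_right (by positivity))
      · rw [mul_comm (‖ξ'‖ ^ 2)]
        exact (aux _ _ hq hle (by linarith)).trans (le_add_of_nonneg_left (by positivity))
    _ = ENNReal.ofReal (16 * π * ‖ξ‖) := by
      rw [lintegral_const_mul' _ _ ENNReal.ofReal_ne_top, lintegral_add_left hmeas,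
        lintegral_sub_right_eq_self h ξ, lintegral_inv_norm_sq_mul_inv ha0,
        ← ENNReal.ofReal_add (by positivity) (by positivity),
        ← ENNReal.ofReal_mul (by positivity)]
      congr 1
      rw [ha]
      field_simp
      ring

end Schur

section KatoInequality

open Set

variable {H : Type*} [NormedAddCommGroup H] [InnerProductSpace ℂ H] [CompleteSpace H]

lemma lintegral_fourierInv_mul_inv_norm_sub_le_kernel {v : ℝ³ → H} (hv : Integrable v)
    (hvm : Measurable fun ξ ↦ ‖v ξ‖) (y : ℝ³) :
    ∫⁻ x, ENNReal.ofReal (‖𝓕⁻ v x‖ ^ 2 * ‖x - y‖⁻¹) ≤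
      ∫⁻ ξ, ∫⁻ ξ', ENNReal.ofReal (‖v ξ‖ * ‖v ξ'‖ * (π * ‖ξ' - ξ‖ ^ 2)⁻¹) := by
  have hχ := (continuous_fourierInv hv).norm.measurable
  set k : ℝ³ → ℝ³ → ℝ → ENNReal := fun ξ ξ' s ↦ ENNReal.ofReal (‖v ξ‖ * ‖v ξ'‖ *
    (2 * ((s ^ 2) ^ (-(3 / 2) : ℝ) * rexp (-(π / s ^ 2) * ‖ξ' - ξ‖ ^ 2)))) with hk
  have hkm : Measurable fun p : ℝ³ × ℝ³ × ℝ ↦ k p.1 p.2.1 p.2.2 := by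
    have h1 : Measurable fun p : ℝ³ × ℝ³ × ℝ ↦ ‖v p.1‖ := hvm.comp measurable_fst
    have h2 : Measurable fun p : ℝ³ × ℝ³ × ℝ ↦ ‖v p.2.1‖ :=
      hvm.comp (measurable_fst.comp measurable_snd)
    simp only [hk]
    fun_prop
  calc
    _ ≤ ∫⁻ x, ∫⁻ s in Ioi (0 : ℝ), ENNReal.ofReal
          (‖𝓕⁻ v x‖ ^ 2 * (2 * rexp (-(π * s ^ 2) * ‖x - y‖ ^ 2))) := by
      refine lintegral_mono fun x ↦ ?_
      simp_rw [ENNReal.ofReal_mul (sq_nonneg ‖𝓕⁻ v x‖)]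
      rw [lintegral_const_mul' _ _ ENNReal.ofReal_ne_top]
      gcongr
      exact ofReal_inv_le_lintegral_gaussian _
    _ = ∫⁻ s in Ioi (0 : ℝ), ∫⁻ x, ENNReal.ofReal
          (‖𝓕⁻ v x‖ ^ 2 * (2 * rexp (-(π * s ^ 2) * ‖x - y‖ ^ 2))) := by
      refine lintegral_lintegral_swap (Measurable.aemeasurable ?_)
      change Measurable fun p : ℝ³ × ℝ ↦ ENNReal.ofReal
        (‖𝓕⁻ v p.1‖ ^ 2 * (2 * rexp (-(π * p.2 ^ 2) * ‖p.1 - y‖ ^ 2)))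
      have : Measurable fun p : ℝ³ × ℝ ↦ ‖𝓕⁻ v p.1‖ := hχ.comp measurable_fst
      fun_prop
    _ ≤ ∫⁻ s in Ioi (0 : ℝ), ∫⁻ ξ, ∫⁻ ξ', k ξ ξ' s := by
      refine setLIntegral_mono' measurableSet_Ioi fun s hs ↦ ?_
      have hs : 0 < s := hs
      have h2 : ∀ a c : ℝ, ENNReal.ofReal (a * (2 * c)) = 2 * ENNReal.ofReal (a * c) := by
        intro a c
        rw [mul_left_comm, ENNReal.ofReal_mul zero_le_two, ENNReal.ofReal_ofNat]
      simp only [hk, h2, lintegral_const_mul' _ _ ENNReal.ofNat_ne_top]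
      exact mul_le_mul_right (lintegral_fourierInv_mul_gaussian_le hv (by positivity) y) 2
    _ = ∫⁻ ξ, ∫⁻ s in Ioi (0 : ℝ), ∫⁻ ξ', k ξ ξ' s := by
      refine lintegral_lintegral_swap (Measurable.aemeasurable ?_)
      refine Measurable.lintegral_prod_right' (f := fun p : (ℝ × ℝ³) × ℝ³ ↦ k p.1.2 p.2 p.1.1) ?_
      exact hkm.comp (f := fun p : (ℝ × ℝ³) × ℝ³ ↦ (p.1.2, p.2, p.1.1)) (by fun_prop)
    _ = ∫⁻ ξ, ∫⁻ ξ', ∫⁻ s in Ioi (0 : ℝ), k ξ ξ' s := by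
      refine lintegral_congr fun ξ ↦ lintegral_lintegral_swap (Measurable.aemeasurable ?_)
      exact hkm.comp (f := fun p : ℝ × ℝ³ ↦ (ξ, p.2, p.1)) (by fun_prop)
    _ = _ := by
      refine lintegral_congr fun ξ ↦ lintegral_congr_ae ?_
      filter_upwards [Measure.ae_ne volume ξ] with ξ' hξ'
      have hr : 0 < ‖ξ' - ξ‖ := norm_pos_iff.2 (sub_ne_zero.2 hξ')
      simp_rw [hk, ENNReal.ofReal_mul (mul_nonneg (norm_nonneg (v ξ)) (norm_nonneg (v ξ')))]
      rw [lintegral_const_mul' _ _ (by finiteness), lintegral_gaussian_inv_sq hr]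

/-- A non-sharp Kato inequality for inverse Fourier transforms. -/
lemma lintegral_fourierInv_mul_inv_norm_sub_le {v : ℝ³ → H} (hv : Integrable v)
    (hvm : Measurable fun ξ ↦ ‖v ξ‖) (y : ℝ³) :
    ∫⁻ x, ENNReal.ofReal (‖𝓕⁻ v x‖ ^ 2 * ‖x - y‖⁻¹) ≤
      ∫⁻ ξ, ENNReal.ofReal (16 * π * (‖ξ‖ * ‖v ξ‖ ^ 2)) := by
  refine (lintegral_fourierInv_mul_inv_norm_sub_le_kernel hv hvm y).trans ?_
  refine (lintegral_schur_test (w := fun ξ : ℝ³ ↦ ‖ξ‖ ^ 2)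
    (K := fun ξ ξ' ↦ (π * ‖ξ' - ξ‖ ^ 2)⁻¹) hvm (by fun_prop)
    (by unfold Function.uncurry; fun_prop) (fun _ _ ↦ by positivity)
    (fun _ _ ↦ by rw [norm_sub_rev]) ?_).trans (lintegral_mono fun ξ ↦ ?_)
  · filter_upwards [Measure.ae_ne volume (0 : ℝ³)] with ξ hξ
    have := norm_pos_iff.2 hξ
    positivity
  · refine (mul_le_mul_right (lintegral_coulomb_kernel_le ξ) _).trans_eq ?_
    rw [← ENNReal.ofReal_mul (sq_nonneg _)]
    ring_nf

lemma lintegral_gaussian_kernel_eq_one {b : ℝ} (hb : 0 < b) (ξ : ℝ³) :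
    ∫⁻ ξ', ENNReal.ofReal (b ^ (-(3 / 2) : ℝ) * rexp (-(π / b) * ‖ξ' - ξ‖ ^ 2)) = 1 := by
  have hint := integrable_gaussian_sub (inv_pos.2 hb) ξ
  rw [← div_eq_mul_inv] at hint
  rw [← ofReal_integral_eq_lintegral_ofReal (hint.const_mul _) (ae_of_all _ fun x ↦ by positivity),
    integral_const_mul, integral_sub_right_eq_self (fun x : ℝ³ ↦ rexp (-(π / b) * ‖x‖ ^ 2)) ξ,
    GaussianFourier.integral_rexp_neg_mul_sq_norm (by positivity), div_div_cancel₀ pi_ne_zero,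
    finrank_euclideanSpace_fin, ← Real.rpow_add hb]
  norm_num

lemma lintegral_fourierInv_sq_mul_gaussian_le {v : ℝ³ → H} (hv : Integrable v)
    (hvm : Measurable fun ξ ↦ ‖v ξ‖) {b : ℝ} (hb : 0 < b) :
    ∫⁻ x, ENNReal.ofReal (‖𝓕⁻ v x‖ ^ 2 * rexp (-(π * b) * ‖x‖ ^ 2)) ≤
      ∫⁻ ξ, ENNReal.ofReal (‖v ξ‖ ^ 2) := by
  have h := lintegral_fourierInv_mul_gaussian_le hv hb 0
  simp only [sub_zero] at h
  refine (h.trans (lintegral_schur_test (w := fun _ : ℝ³ ↦ (1 : ℝ))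
    (K := fun ξ ξ' ↦ b ^ (-(3 / 2) : ℝ) * rexp (-(π / b) * ‖ξ' - ξ‖ ^ 2)) hvm (by fun_prop)
    (by unfold Function.uncurry; fun_prop) (fun _ _ ↦ by positivity)
    (fun _ _ ↦ by rw [norm_sub_rev]) (ae_of_all _ fun _ ↦ one_pos))).trans_eq
    (lintegral_congr fun ξ ↦ ?_)
  simp only [div_one, one_mul]
  rw [lintegral_gaussian_kernel_eq_one hb, mul_one]

/-- Bessel's inequality for the inverse Fourier transform of an integrable function. -/
lemma lintegral_fourierInv_sq_le {v : ℝ³ → H} (hv : Integrable v)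
    (hvm : Measurable fun ξ ↦ ‖v ξ‖) :
    ∫⁻ x, ENNReal.ofReal (‖𝓕⁻ v x‖ ^ 2) ≤ ∫⁻ ξ, ENNReal.ofReal (‖v ξ‖ ^ 2) := by
  have hχ := (continuous_fourierInv hv).norm.measurable
  have hb : ∀ n : ℕ, 0 < 1 / ((n : ℝ) + 1) := fun n ↦ Nat.one_div_pos_of_nat
  have hlim : ∀ x : ℝ³, Filter.Tendsto (fun n : ℕ ↦ ENNReal.ofReal
      (‖𝓕⁻ v x‖ ^ 2 * rexp (-(π * (1 / ((n : ℝ) + 1))) * ‖x‖ ^ 2))) Filter.atTop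
      (nhds (ENNReal.ofReal (‖𝓕⁻ v x‖ ^ 2))) := by
    intro x
    have hc : Continuous fun t : ℝ ↦ ‖𝓕⁻ v x‖ ^ 2 * rexp (-(π * t) * ‖x‖ ^ 2) := by fun_prop
    have := (hc.tendsto 0).comp (tendsto_one_div_add_atTop_nhds_zero_nat (𝕜 := ℝ))
    rw [mul_zero, neg_zero, zero_mul, Real.exp_zero, mul_one] at this
    exact ENNReal.tendsto_ofReal this
  calc
    _ = ∫⁻ x, Filter.liminf (fun n : ℕ ↦ ENNReal.ofReal
        (‖𝓕⁻ v x‖ ^ 2 * rexp (-(π * (1 / ((n : ℝ) + 1))) * ‖x‖ ^ 2))) Filter.atTop :=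
      lintegral_congr fun x ↦ (hlim x).liminf_eq.symm
    _ ≤ Filter.liminf (fun n : ℕ ↦ ∫⁻ x, ENNReal.ofReal
        (‖𝓕⁻ v x‖ ^ 2 * rexp (-(π * (1 / ((n : ℝ) + 1))) * ‖x‖ ^ 2))) Filter.atTop :=
      lintegral_liminf_le fun n ↦ by fun_prop
    _ ≤ Filter.liminf (fun _ : ℕ ↦ ∫⁻ ξ, ENNReal.ofReal (‖v ξ‖ ^ 2)) Filter.atTop :=
      Filter.liminf_le_liminf (Filter.Eventually.of_forall fun n ↦
        lintegral_fourierInv_sq_mul_gaussian_le hv hvm (hb n))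
    _ = _ := Filter.liminf_const _

end KatoInequality

section Pauli

local notation "ℂ²" => EuclideanSpace ℂ (Fin 2)

lemma norm_sum_smul_pauli (ξ : ℝ³) (u : ℂ²) :
    ‖∑ j : Fin 3, (ξ j : ℂ) • Matrix.toEuclideanCLM (𝕜 := ℂ) (pauli j) u‖ = ‖ξ‖ * ‖u‖ := by
  rw [← sq_eq_sq₀ (norm_nonneg _) (by positivity), mul_pow, EuclideanSpace.norm_sq_eq,
    EuclideanSpace.norm_sq_eq, EuclideanSpace.norm_sq_eq]
  simp only [Fin.sum_univ_two, Fin.sum_univ_three, pauli, PiLp.add_apply, PiLp.smul_apply,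
    Matrix.ofLp_toEuclideanCLM]
  simp [Matrix.mulVec, dotProduct, Fin.sum_univ_two, Complex.sq_norm, Complex.normSq_apply]
  ring

variable {φ : ℝ³ → ℂ²}

lemma pauliDeriv_eq_sum (φ : ℝ³ → ℂ²) (x : ℝ³) :
    pauliDeriv φ x = ∑ j : Fin 3, Matrix.toEuclideanCLM (𝕜 := ℂ) (pauli j)
      (fderiv ℝ φ x (EuclideanSpace.single j 1)) := rfl

lemma continuous_pauliDeriv (hφ : ContDiff ℝ (⊤ : ℕ∞) φ) : Continuous (pauliDeriv φ) := by
  have := hφ.continuous_fderiv (by simp)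
  simp_rw [funext (pauliDeriv_eq_sum φ)]
  fun_prop

lemma hasCompactSupport_pauliDeriv (hsupp : HasCompactSupport φ) :
    HasCompactSupport (pauliDeriv φ) := by
  refine (hsupp.fderiv (𝕜 := ℝ)).mono fun x hx h ↦ hx ?_
  simp [pauliDeriv_eq_sum, h]

lemma fourier_pauliDeriv (hφ : ContDiff ℝ (⊤ : ℕ∞) φ) (hsupp : HasCompactSupport φ) (ξ : ℝ³) :
    𝓕 (pauliDeriv φ) ξ = (2 * π * Complex.I) •
      ∑ j : Fin 3, (ξ j : ℂ) • Matrix.toEuclideanCLM (𝕜 := ℂ) (pauli j) (𝓕 φ ξ) := by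
  have hφi : Integrable φ := hφ.continuous.integrable_of_hasCompactSupport hsupp
  have hdi : Integrable (fderiv ℝ φ) :=
    (hφ.continuous_fderiv (by simp)).integrable_of_hasCompactSupport (hsupp.fderiv (𝕜 := ℝ))
  have hcomp (j : Fin 3) : 𝓕 (fun x ↦ fderiv ℝ φ x (EuclideanSpace.single j 1)) ξ =
      (2 * π * Complex.I * ξ j) • 𝓕 φ ξ := by
    rw [← Real.fourier_continuousLinearMap_apply hdi,
      Real.fourier_fderiv hφi (hφ.differentiable (by simp)) hdi]
    simp [VectorFourier.fourierSMulRight_apply, ← Complex.coe_smul, smul_smul,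
      innerSL_apply_apply ℝ, EuclideanSpace.inner_single_right]
  have hint (j : Fin 3) : Integrable fun x ↦
      Real.fourierChar (-inner ℝ x ξ) • fderiv ℝ φ x (EuclideanSpace.single j 1) :=
    (Real.fourierIntegral_convergent_iff ξ).2 (hdi.apply_continuousLinearMap _)
  rw [Real.fourier_eq, Finset.smul_sum]
  simp only [pauliDeriv_eq_sum, Finset.smul_sum, Circle.smul_def, ← map_smul]
  simp only [← Circle.smul_def]
  rw [integral_finsetSum _ fun j _ ↦ ContinuousLinearMap.integrable_comp _ (hint j)]
  refine Finset.sum_congr rfl fun j _ ↦ ?_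
  rw [ContinuousLinearMap.integral_comp_comm _ (hint j), ← Real.fourier_eq, hcomp, smul_smul]

lemma norm_fourier_pauliDeriv (hφ : ContDiff ℝ (⊤ : ℕ∞) φ) (hsupp : HasCompactSupport φ)
    (ξ : ℝ³) : ‖𝓕 (pauliDeriv φ) ξ‖ = 2 * π * ‖ξ‖ * ‖𝓕 φ ξ‖ := by
  rw [fourier_pauliDeriv hφ hsupp, norm_smul, norm_sum_smul_pauli]
  simp [abs_of_pos pi_pos, mul_assoc]

end Pauli

section Coulomb

lemma measurable_coulomb (m : Measure ℝ³) [IsFiniteMeasure m] : Measurable (coulomb m) := by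
  refine Measurable.ennreal_toReal (Measurable.lintegral_prod_right'
    (f := fun p : ℝ³ × ℝ³ ↦ ENNReal.ofReal ‖p.1 - p.2‖⁻¹) ?_)
  fun_prop

lemma lintegral_fourierInv_mul_coulomb_le {H : Type*} [NormedAddCommGroup H]
    [InnerProductSpace ℂ H] [CompleteSpace H] (m : Measure ℝ³) [IsFiniteMeasure m]
    {v : ℝ³ → H} (hv : Integrable v) (hvm : Measurable fun ξ ↦ ‖v ξ‖) :
    ∫⁻ x, ENNReal.ofReal (‖𝓕⁻ v x‖ ^ 2 * coulomb m x) ≤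
      (∫⁻ ξ, ENNReal.ofReal (16 * π * (‖ξ‖ * ‖v ξ‖ ^ 2))) * m Set.univ := by
  have hχ := (continuous_fourierInv hv).norm.measurable
  calc
    _ ≤ ∫⁻ x, ∫⁻ y, ENNReal.ofReal (‖𝓕⁻ v x‖ ^ 2 * ‖x - y‖⁻¹) ∂m := by
      refine lintegral_mono fun x ↦ ?_
      simp_rw [ENNReal.ofReal_mul (sq_nonneg ‖𝓕⁻ v x‖)]
      rw [lintegral_const_mul' _ _ ENNReal.ofReal_ne_top]
      gcongr
      exact ENNReal.ofReal_toReal_le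
    _ = ∫⁻ y, ∫⁻ x, ENNReal.ofReal (‖𝓕⁻ v x‖ ^ 2 * ‖x - y‖⁻¹) ∂volume ∂m := by
      refine lintegral_lintegral_swap (Measurable.aemeasurable ?_)
      change Measurable fun p : ℝ³ × ℝ³ ↦ ENNReal.ofReal (‖𝓕⁻ v p.1‖ ^ 2 * ‖p.1 - p.2‖⁻¹)
      have : Measurable fun p : ℝ³ × ℝ³ ↦ ‖𝓕⁻ v p.1‖ := hχ.comp measurable_fst
      fun_prop
    _ ≤ ∫⁻ _, (∫⁻ ξ, ENNReal.ofReal (16 * π * (‖ξ‖ * ‖v ξ‖ ^ 2))) ∂m :=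
      lintegral_mono fun y ↦ lintegral_fourierInv_mul_inv_norm_sub_le hv hvm y
    _ = _ := lintegral_const _

end Coulomb

lemma two_mul_re_inner_sub_le_sq_div {H : Type*} [NormedAddCommGroup H]
    [InnerProductSpace ℂ H] (g χ : H) {W : ℝ} (hW : 0 < W) {c : ℝ} (hc : 0 ≤ c) :
    2 * c * (inner ℂ g χ).re - c ^ 2 * (‖χ‖ ^ 2 * W) ≤ ‖g‖ ^ 2 / W := by
  have h1 : (inner ℂ g χ).re ≤ ‖g‖ * ‖χ‖ := (Complex.re_le_norm _).trans (norm_inner_le_norm _ _)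
  rw [le_div_iff₀ hW]
  have h2 := mul_le_mul_of_nonneg_left h1 (mul_nonneg hc hW.le)
  nlinarith [sq_nonneg (‖g‖ - c * W * ‖χ‖)]

lemma integrable_and_integral_le_of_lintegral_le {α : Type*} [MeasurableSpace α] {μ : Measure α}
    {f : α → ℝ} (hf : AEStronglyMeasurable f μ) (hf0 : ∀ x, 0 ≤ f x) {B : ℝ} (hB : 0 ≤ B)
    (h : ∫⁻ x, ENNReal.ofReal (f x) ∂μ ≤ ENNReal.ofReal B) :
    Integrable f μ ∧ ∫ x, f x ∂μ ≤ B := by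
  refine ⟨⟨hf, ?_⟩, ?_⟩
  · rw [hasFiniteIntegral_iff_ofReal (ae_of_all _ hf0)]
    exact h.trans_lt ENNReal.ofReal_lt_top
  · rw [integral_eq_lintegral_of_nonneg_ae (ae_of_all _ hf0) hf]
    exact ENNReal.toReal_le_of_le_ofReal hB h


theorem weighted_pauli_lower_bound
    (m : Measure (EuclideanSpace ℝ (Fin 3))) [IsFiniteMeasure m]
    (η : ℝ) (hη : 0 < η)
    (φ : EuclideanSpace ℝ (Fin 3) → EuclideanSpace ℂ (Fin 2))
    (hφ : ContDiff ℝ (⊤ : ℕ∞) φ) (hsupp : HasCompactSupport φ) :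
    ∫ x, ‖pauliDeriv φ x‖ ^ 2 / (η + coulomb m x) ≥
      (2 * π * (∫ ξ, ‖ξ‖ * ‖𝓕 φ ξ‖ ^ 2) - η * ∫ x, ‖φ x‖ ^ 2) /
        (2 * max 1 (8 * (m Set.univ).toReal)) := by
  let f := hsupp.toSchwartzMap hφ
  set g := pauliDeriv φ
  have hgc : Continuous g := continuous_pauliDeriv hφ
  have hgs : HasCompactSupport g := hasCompactSupport_pauliDeriv hsupp
  have hgi : Integrable g := hgc.integrable_of_hasCompactSupport hgs
  have hFg : ∀ ξ, ‖𝓕 g ξ‖ = 2 * π * ‖ξ‖ * ‖𝓕 φ ξ‖ := norm_fourier_pauliDeriv hφ hsupp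
  have hFgc : Continuous (𝓕 g) := VectorFourier.fourierIntegral_continuous
    Real.continuous_fourierChar (by exact continuous_inner) hgi
  have hFi : Integrable (𝓕 φ) := (𝓕 f).integrable
  have hFc : Continuous (𝓕 φ) := (𝓕 f).continuous
  have hN : ∫ ξ, ‖𝓕 φ ξ‖ ^ 2 = ∫ x, ‖φ x‖ ^ 2 := SchwartzMap.integral_norm_sq_fourier f
  have hFsq : Integrable fun ξ ↦ ‖𝓕 φ ξ‖ ^ 2 :=
    (memLp_two_iff_integrable_sq_norm hFc.aestronglyMeasurable).1 ((𝓕 f).memLp 2 volume)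
  have hAi : Integrable fun ξ ↦ ‖ξ‖ * ‖𝓕 φ ξ‖ ^ 2 := by
    have h1 : Integrable fun ξ ↦ ‖ξ‖ ^ 1 * ‖𝓕 φ ξ‖ := (𝓕 f).integrable_pow_mul volume 1
    refine (h1.mul_const (∫ x, ‖φ x‖)).mono' (by fun_prop) (ae_of_all _ fun ξ ↦ ?_)
    have h2 : ‖𝓕 φ ξ‖ ≤ ∫ x, ‖φ x‖ := by
      rw [Real.fourier_eq]
      exact (norm_integral_le_integral_norm _).trans_eq (by simp)
    rw [Real.norm_of_nonneg (by positivity), pow_one, sq, ← mul_assoc]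
    gcongr
  set I := ∫ ξ, ‖ξ‖ * ‖𝓕 φ ξ‖ ^ 2 with hI
  set N := ∫ x, ‖φ x‖ ^ 2
  have hI0 : 0 ≤ I := integral_nonneg fun ξ ↦ by positivity
  have hN0 : 0 ≤ N := integral_nonneg fun x ↦ by positivity
  set v : EuclideanSpace ℝ (Fin 3) → EuclideanSpace ℂ (Fin 2) :=
    fun ξ ↦ (((2 * π * ‖ξ‖)⁻¹ : ℝ) : ℂ) • 𝓕 g ξ with hv
  have hvmeas : Measurable v := by fun_prop
  have hvle : ∀ ξ, ‖v ξ‖ ≤ ‖𝓕 φ ξ‖ := by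
    intro ξ
    rw [hv, norm_smul, Complex.norm_real, Real.norm_of_nonneg (by positivity), hFg, ← mul_assoc]
    exact mul_le_of_le_one_left (norm_nonneg _) inv_mul_le_one
  have hvi : Integrable v := hFi.mono hvmeas.aestronglyMeasurable (ae_of_all _ hvle)
  set χ := 𝓕⁻ v
  have hχc : Continuous χ := continuous_fourierInv hvi
  have hpair : ∫ x, (inner ℂ (g x) (χ x)).re = 2 * π * I := by
    have hgχ : Integrable fun x ↦ inner ℂ (g x) (χ x) :=
      (hgc.inner hχc).integrable_of_hasCompactSupport
        (hgs.mono fun x hx h ↦ hx (by simp [h]))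
    have h := integral_inner_fourier_left hgi hvi
    have hre := integral_re hgχ
    simp only [RCLike.re_to_complex] at hre
    rw [hre, ← h, hI, ← integral_const_mul]
    have : ∀ ξ, inner ℂ (𝓕 g ξ) (v ξ) = ((2 * π * (‖ξ‖ * ‖𝓕 φ ξ‖ ^ 2) : ℝ) : ℂ) := by
      intro ξ
      have hcancel : (2 * π * ‖ξ‖)⁻¹ * (2 * π * ‖ξ‖ * ‖𝓕 φ ξ‖) ^ 2 =
          2 * π * (‖ξ‖ * ‖𝓕 φ ξ‖ ^ 2) := by
        rcases eq_or_ne ‖ξ‖ 0 with hξ | hξ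
        · simp [hξ]
        · field_simp
      rw [hv, inner_smul_right, inner_self_eq_norm_sq_to_K, hFg, ← hcancel,
        Complex.ofReal_mul, Complex.ofReal_pow]
      rfl
    simp_rw [this]
    rw [integral_complex_ofReal, Complex.ofReal_re]
  obtain ⟨hχi, hχN⟩ : Integrable (fun x ↦ ‖χ x‖ ^ 2) ∧ ∫ x, ‖χ x‖ ^ 2 ≤ N := by
    refine integrable_and_integral_le_of_lintegral_le (by fun_prop) (fun x ↦ by positivity) hN0 ?_
    refine (lintegral_fourierInv_sq_le hvi hvmeas.norm).trans ?_
    rw [← hN, ofReal_integral_eq_lintegral_ofReal hFsq (ae_of_all _ fun ξ ↦ by positivity)]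
    gcongr with ξ
    exact hvle ξ
  have hV0 : ∀ x, 0 ≤ coulomb m x := fun x ↦ ENNReal.toReal_nonneg
  have hVm : Measurable (coulomb m) := measurable_coulomb m
  set M := (m Set.univ).toReal with hM
  have hM0 : 0 ≤ M := ENNReal.toReal_nonneg
  obtain ⟨hχVi, hχV⟩ : Integrable (fun x ↦ ‖χ x‖ ^ 2 * coulomb m x) ∧
      ∫ x, ‖χ x‖ ^ 2 * coulomb m x ≤ 16 * π * I * M := by
    refine integrable_and_integral_le_of_lintegral_le (by fun_prop)
      (fun x ↦ mul_nonneg (sq_nonneg _) (hV0 x)) (by positivity) ?_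
    refine (lintegral_fourierInv_mul_coulomb_le m hvi hvmeas.norm).trans ?_
    rw [ENNReal.ofReal_mul (by positivity), hM, ENNReal.ofReal_toReal (measure_ne_top _ _), hI,
      ← integral_const_mul, ofReal_integral_eq_lintegral_ofReal (hAi.const_mul _)
        (ae_of_all _ fun ξ ↦ by positivity)]
    gcongr with ξ
    exact hvle ξ
  have hJi : Integrable fun x ↦ ‖g x‖ ^ 2 / (η + coulomb m x) := by
    have h1 : Integrable fun x ↦ ‖g x‖ ^ 2 / η :=
      ((hgc.norm.pow 2).integrable_of_hasCompactSupport
        (hgs.mono fun x hx h ↦ hx (by simp [h]))).div_const η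
    refine h1.mono' ((hgc.norm.measurable.pow_const 2).div
      (hVm.const_add η)).aestronglyMeasurable (ae_of_all _ fun x ↦ ?_)
    have := hV0 x
    rw [Real.norm_of_nonneg (by positivity)]
    gcongr
    linarith
  have hgχ : Integrable fun x ↦ (inner ℂ (g x) (χ x)).re :=
    (Complex.continuous_re.comp (hgc.inner hχc)).integrable_of_hasCompactSupport
      (hgs.mono fun x hx h ↦ hx (by simp [h]))
  set K := max 1 (8 * M)
  have hK1 : 1 ≤ K := le_max_left _ _
  have hK8 : 8 * M ≤ K := le_max_right _ _
  have hWi : Integrable fun x ↦ ‖χ x‖ ^ 2 * (η + coulomb m x) := by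
    simp only [mul_add]
    exact (hχi.mul_const η).add hχVi
  have hW : ∫ x, ‖χ x‖ ^ 2 * (η + coulomb m x) ≤ N * η + 16 * π * I * M := by
    simp_rw [mul_add]
    rw [integral_add (hχi.mul_const η) hχVi, integral_mul_const]
    gcongr
  have hmain : ∀ c : ℝ, 0 ≤ c →
      2 * c * (2 * π * I) - c ^ 2 * (N * η + 16 * π * I * M) ≤
        ∫ x, ‖g x‖ ^ 2 / (η + coulomb m x) := by
    intro c hc
    have h1 := integral_mono ((hgχ.const_mul (2 * c)).sub (hWi.const_mul (c ^ 2))) hJi fun x ↦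
      two_mul_re_inner_sub_le_sq_div (g x) (χ x) (add_pos_of_pos_of_nonneg hη (hV0 x)) hc
    rw [integral_sub' (hgχ.const_mul (2 * c)) (hWi.const_mul (c ^ 2)), integral_const_mul,
      integral_const_mul, hpair] at h1
    nlinarith [mul_le_mul_of_nonneg_left hW (sq_nonneg c)]
  refine ge_iff_le.2 (le_trans ?_ (hmain (1 / (2 * K)) (by positivity)))
  have hIK : 8 * M * (π * I) ≤ K * (π * I) := by gcongr
  have hNK : N * η ≤ K * (N * η) := le_mul_of_one_le_left (by positivity) hK1
  have hπI : 0 ≤ K * (π * I) := by positivity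
  have hNη : 0 ≤ N * η := by positivity
  rw [show 2 * (1 / (2 * K)) * (2 * π * I) - (1 / (2 * K)) ^ 2 * (N * η + 16 * π * I * M) =
    (8 * K * (π * I) - (N * η + 16 * π * I * M)) / (4 * K ^ 2) by field_simp; ring,
    div_le_div_iff₀ (by positivity) (by positivity)]
  have hfac : (2 * π * I - η * N) * (2 * K) ≤ 8 * K * (π * I) - (N * η + 16 * π * I * M) := by
    nlinarith
  calc
    _ = (2 * π * I - η * N) * (2 * K) * (2 * K) := by ring
    _ ≤ _ := by gcongr
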